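/- Let G₁ and G₂ be groups and let π₁ : F₁ → G₁, π₂ : F₂ → G₂ and π : F → G₁ × G₂ be surjective group homomorphisms from free groups, with kernels R₁ = ker π₁, R₂ = ker π₂ and R = ker π. Then there is a group isomorphism (R ∩ F')/⟨K(F) ∩ R⟩ ≅ (R₁ ∩ F₁')/⟨K(F₁) ∩ R₁⟩ × (R₂ ∩ F₂')/⟨K(F₂) ∩ R₂⟩; that is, B̃₀(G₁ × G₂) ≅ B̃₀(G₁) × B̃₀(G₂) for the abelian variety. -/

import Mathlib

open Subgroup

/-- `Kcl S = ⟨K(F) ∩ S⟩`: the subgroup of `F` generated by the commutators of `F`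
that lie in `S`. -/
def Kcl {F : Type*} [Group F] (S : Subgroup F) : Subgroup F :=
  Subgroup.closure (commutatorSet F ∩ (S : Set F))

instance Kcl_normal {F : Type*} [Group F] (S : Subgroup F) [hS : S.Normal] :
    (Kcl S).Normal := by
  constructor
  intro n hn g
  induction hn using Subgroup.closure_induction with
  | mem x hx =>
      obtain ⟨⟨a, b, hab⟩, hxS⟩ := hx
      apply Subgroup.subset_closure
      refine ⟨⟨g * a * g⁻¹, g * b * g⁻¹, ?_⟩, hS.conj_mem x hxS g⟩
      rw [← conjugate_commutatorElement, hab]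
  | one => simpa using (Kcl S).one_mem
  | mul x y _ _ hx hy =>
      have h : g * (x * y) * g⁻¹ = (g * x * g⁻¹) * (g * y * g⁻¹) := by group
      rw [h]; exact mul_mem hx hy
  | inv x _ hx =>
      have h : g * x⁻¹ * g⁻¹ = (g * x * g⁻¹)⁻¹ := by group
      rw [h]; exact inv_mem hx

theorem Kcl_le {F : Type*} [Group F] (S : Subgroup F) : Kcl S ≤ S :=
  (Subgroup.closure_le S).2 Set.inter_subset_right

theorem Kcl_le_commutator {F : Type*} [Group F] (S : Subgroup F) :
    Kcl S ≤ commutator F := by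
  rw [commutator_eq_closure]
  exact Subgroup.closure_mono Set.inter_subset_left

theorem Kcl_mono {F : Type*} [Group F] {R K : Subgroup F} (h : R ≤ K) : Kcl R ≤ Kcl K :=
  Subgroup.closure_mono (Set.inter_subset_inter_right _ h)

theorem subgroupOf_le_comap_inclusion {F : Type*} [Group F] {A B H₁ H₂ : Subgroup F}
    (hH : H₁ ≤ H₂) (hAB : A ≤ B) :
    A.subgroupOf H₁ ≤ (B.subgroupOf H₂).comap (Subgroup.inclusion hH) := by
  intro x hx
  rw [Subgroup.mem_comap, Subgroup.mem_subgroupOf, Subgroup.coe_inclusion]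
  exact hAB (Subgroup.mem_subgroupOf.mp hx)

open scoped commutatorElement

theorem aux_central {F G : Type*} [Group F] [Group G] (π : F →* G) (r y : F)
    (hr : r ∈ π.ker) : (r : F ⧸ Kcl π.ker) * y = y * r := by
  have h : ⁅r, y⁆ ∈ Kcl π.ker := by
    apply Subgroup.subset_closure
    refine ⟨⟨r, y, rfl⟩, ?_⟩
    have : π r = 1 := hr
    simp [MonoidHom.mem_ker, map_commutatorElement, this]
  have h2 : ((⁅r, y⁆ : F) : F ⧸ Kcl π.ker) = 1 := (QuotientGroup.eq_one_iff _).2 h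
  rw [commutatorElement_def] at h2
  simp only [QuotientGroup.mk_mul, QuotientGroup.mk_inv] at h2
  rwa [← commutatorElement_def, commutatorElement_eq_one_iff_mul_comm] at h2

theorem aux_eq {H F G : Type*} [Group H] [Group F] [Group G] (π : F →* G)
    (f g : H →* F ⧸ Kcl π.ker)
    (h : ∀ x, ∃ r ∈ π.ker, f x = g x * (r : F ⧸ Kcl π.ker)) :
    ∀ x ∈ commutator H, f x = g x := by
  have hle : commutator H ≤ f.eqLocus g := by
    rw [commutator_eq_closure, Subgroup.closure_le]
    rintro _ ⟨x, y, rfl⟩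
    change f _ = g _
    obtain ⟨r, hr, hx⟩ := h x
    obtain ⟨s, hs, hy⟩ := h y
    have cen : ∀ r ∈ π.ker, ∀ q : F ⧸ Kcl π.ker, (r : F ⧸ Kcl π.ker) * q = q * r := by
      intro r hr q
      induction q using QuotientGroup.induction_on with
      | H z => exact aux_central π r z hr
    have cr := cen r hr
    have cs := cen s hs
    rw [map_commutatorElement, map_commutatorElement, hx, hy]
    generalize (r : F ⧸ Kcl π.ker) = r at *
    generalize (s : F ⧸ Kcl π.ker) = s at *
    generalize g x = a at *
    generalize g y = b at *
    have e : (a * r) * (b * s) = (a * b) * (r * s) := by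
      rw [mul_assoc, ← mul_assoc r, cr b]; group
    have e2 : (b * s) * (a * r) = (b * a) * (r * s) := by
      rw [mul_assoc, ← mul_assoc s, cs a, cr s]; group
    have e3 : ∀ u v : F ⧸ Kcl π.ker, ⁅u, v⁆ = (u * v) * (v * u)⁻¹ := by
      intro u v; rw [commutatorElement_def]; group
    rw [e3, e3, e, e2]; group
  exact fun x hx => hle hx

theorem aux_lift {H F G : Type*} [Group H] [Group F] [Group G] (π : F →* G)
    (f g : H →* F) (h : ∀ x, π (f x) = π (g x)) :
    ∀ x ∈ commutator H, ((f x : F) : F ⧸ Kcl π.ker) = g x := by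
  refine aux_eq π ((QuotientGroup.mk' _).comp f) ((QuotientGroup.mk' _).comp g) ?_
  intro x
  refine ⟨(g x)⁻¹ * f x, ?_, ?_⟩
  · simp [MonoidHom.mem_ker, h]
  · simp

theorem aux_kcl {H F G G' : Type*} [Group H] [Group F] [Group G] [Group G']
    (π' : H →* G') (π : F →* G) (f : H →* F) (h : π'.ker ≤ π.ker.comap f) :
    Kcl π'.ker ≤ (Kcl π.ker).comap f := by
  refine (Subgroup.closure_le _).2 ?_
  rintro _ ⟨⟨x, y, rfl⟩, hx⟩
  apply Subgroup.subset_closure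
  exact ⟨⟨f x, f y, (map_commutatorElement f x y).symm⟩, h hx⟩

theorem aux_comm {H F : Type*} [Group H] [Group F] (f : H →* F) {x : H}
    (hx : x ∈ commutator H) : f x ∈ commutator F := by
  have hle : commutator H ≤ (commutator F).comap f := by
    rw [commutator_eq_closure, Subgroup.closure_le, commutator_eq_closure]
    rintro _ ⟨x, y, rfl⟩
    exact Subgroup.subset_closure ⟨f x, f y, (map_commutatorElement f x y).symm⟩
  exact hle hx

theorem aux_exists_lift {α F G : Type*} [Group F] [Group G] (π : F →* G)
    (hπ : Function.Surjective π) (f : FreeGroup α →* G) :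
    ∃ φ : FreeGroup α →* F, ∀ x, π (φ x) = f x := by
  choose s hs using hπ
  refine ⟨FreeGroup.lift fun a => s (f (FreeGroup.of a)), fun x => ?_⟩
  have : π.comp (FreeGroup.lift fun a => s (f (FreeGroup.of a))) = f := by
    ext a; simp [hs]
  exact DFunLike.congr_fun this x

/-- The map induced on the quotients by a lift. -/
def auxMap {H F G G' : Type*} [Group H] [Group F] [Group G] [Group G']
    (π' : H →* G') (π : F →* G) (f : H →* F) (h : π'.ker ≤ π.ker.comap f) :
    (↥(π'.ker ⊓ commutator H) ⧸ (Kcl π'.ker).subgroupOf (π'.ker ⊓ commutator H)) →*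
    (↥(π.ker ⊓ commutator F) ⧸ (Kcl π.ker).subgroupOf (π.ker ⊓ commutator F)) :=
  QuotientGroup.map _ _
    ((f.comp (π'.ker ⊓ commutator H).subtype).codRestrict (π.ker ⊓ commutator F)
      (fun x => ⟨h x.2.1, aux_comm f x.2.2⟩))
    (fun x hx => by
      have := aux_kcl π' π f h (Subgroup.mem_subgroupOf.1 hx)
      exact Subgroup.mem_subgroupOf.2 this)

/-- `B̃₀(G₁ × G₂) ≅ B̃₀(G₁) × B̃₀(G₂)` (abelian variety), where
`B̃₀(G) = (R ∩ F')/⟨K(F) ∩ R⟩` for any free presentation `π : F ↠ G`, `R = ker π`. -/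
theorem stmt10 {G₁ G₂ : Type*} [Group G₁] [Group G₂] {α₁ α₂ α : Type*}
    (π₁ : FreeGroup α₁ →* G₁) (hπ₁ : Function.Surjective π₁)
    (π₂ : FreeGroup α₂ →* G₂) (hπ₂ : Function.Surjective π₂)
    (π : FreeGroup α →* G₁ × G₂) (hπ : Function.Surjective π) :
    Nonempty
      ((↥(π.ker ⊓ commutator (FreeGroup α)) ⧸
          (Kcl π.ker).subgroupOf (π.ker ⊓ commutator (FreeGroup α))) ≃*
        (↥(π₁.ker ⊓ commutator (FreeGroup α₁)) ⧸
            (Kcl π₁.ker).subgroupOf (π₁.ker ⊓ commutator (FreeGroup α₁))) ×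
          (↥(π₂.ker ⊓ commutator (FreeGroup α₂)) ⧸
            (Kcl π₂.ker).subgroupOf (π₂.ker ⊓ commutator (FreeGroup α₂)))) := by
  obtain ⟨a₁, ha₁⟩ := aux_exists_lift π₁ hπ₁ ((MonoidHom.fst G₁ G₂).comp π)
  obtain ⟨a₂, ha₂⟩ := aux_exists_lift π₂ hπ₂ ((MonoidHom.snd G₁ G₂).comp π)
  obtain ⟨b₁, hb₁⟩ := aux_exists_lift π hπ ((MonoidHom.inl G₁ G₂).comp π₁)
  obtain ⟨b₂, hb₂⟩ := aux_exists_lift π hπ ((MonoidHom.inr G₁ G₂).comp π₂)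
  simp only [MonoidHom.comp_apply, MonoidHom.coe_fst, MonoidHom.coe_snd,
    MonoidHom.inl_apply, MonoidHom.inr_apply] at ha₁ ha₂ hb₁ hb₂
  have ka₁ : π.ker ≤ π₁.ker.comap a₁ := fun x hx => by
    have : π x = 1 := hx
    simp [MonoidHom.mem_ker, ha₁, this]
  have ka₂ : π.ker ≤ π₂.ker.comap a₂ := fun x hx => by
    have : π x = 1 := hx
    simp [MonoidHom.mem_ker, ha₂, this]
  have kb₁ : π₁.ker ≤ π.ker.comap b₁ := fun x hx => by
    have : π₁ x = 1 := hx
    simp [MonoidHom.mem_ker, hb₁, this]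
  have kb₂ : π₂.ker ≤ π.ker.comap b₂ := fun x hx => by
    have : π₂ x = 1 := hx
    simp [MonoidHom.mem_ker, hb₂, this]
  have h11 := aux_lift π₁ (a₁.comp b₁) (MonoidHom.id _) (by simp [ha₁, hb₁])
  have h22 := aux_lift π₂ (a₂.comp b₂) (MonoidHom.id _) (by simp [ha₂, hb₂])
  have h12 := aux_lift π₁ (a₁.comp b₂) 1 (by simp [ha₁, hb₂])
  have h21 := aux_lift π₂ (a₂.comp b₁) 1 (by simp [ha₂, hb₁])
  have hcomm : ∀ x y, Commute (((QuotientGroup.mk' (Kcl π.ker)).comp b₁) x)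
      (((QuotientGroup.mk' (Kcl π.ker)).comp b₂) y) := by
    intro x y
    rw [← commutatorElement_eq_one_iff_commute, MonoidHom.comp_apply, MonoidHom.comp_apply,
      ← map_commutatorElement]
    refine (QuotientGroup.eq_one_iff _).2 (Subgroup.subset_closure ⟨⟨_, _, rfl⟩, ?_⟩)
    change π _ = 1
    rw [map_commutatorElement, hb₁, hb₂, commutatorElement_def]
    ext <;> simp
  have hc := aux_eq π ((MonoidHom.noncommCoprod _ _ hcomm).comp (a₁.prod a₂))
    (QuotientGroup.mk' (Kcl π.ker)) (by
      intro x
      refine ⟨x⁻¹ * (b₁ (a₁ x) * b₂ (a₂ x)), ?_, ?_⟩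
      · rw [MonoidHom.mem_ker]
        simp only [map_mul, map_inv, hb₁, hb₂, ha₁, ha₂]
        ext <;> simp
      · simp)
  refine ⟨MulEquiv.ofBijective ((auxMap π π₁ a₁ ka₁).prod (auxMap π π₂ a₂ ka₂)) ⟨?_, ?_⟩⟩
  · rw [injective_iff_map_eq_one]
    intro q
    induction q using QuotientGroup.induction_on with
    | H z =>
      intro hq
      have hq1 : a₁ z ∈ Kcl π₁.ker :=
        Subgroup.mem_subgroupOf.1 ((QuotientGroup.eq_one_iff _).1 (congrArg Prod.fst hq))
      have hq2 : a₂ z ∈ Kcl π₂.ker :=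
        Subgroup.mem_subgroupOf.1 ((QuotientGroup.eq_one_iff _).1 (congrArg Prod.snd hq))
      refine (QuotientGroup.eq_one_iff _).2 (Subgroup.mem_subgroupOf.2 ?_)
      have e := hc z z.2.2
      have k1 : ((b₁ (a₁ z) : FreeGroup α) : FreeGroup α ⧸ Kcl π.ker) = 1 :=
        (QuotientGroup.eq_one_iff _).2 (aux_kcl _ _ _ kb₁ hq1)
      have k2 : ((b₂ (a₂ z) : FreeGroup α) : FreeGroup α ⧸ Kcl π.ker) = 1 :=
        (QuotientGroup.eq_one_iff _).2 (aux_kcl _ _ _ kb₂ hq2)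
      refine (QuotientGroup.eq_one_iff _).1 (Eq.trans e.symm ?_)
      simp [k1, k2]
  · rintro ⟨p, q⟩
    induction p using QuotientGroup.induction_on with
    | H x =>
    induction q using QuotientGroup.induction_on with
    | H y =>
      refine ⟨QuotientGroup.mk ⟨b₁ x * b₂ y,
        mul_mem (kb₁ x.2.1) (kb₂ y.2.1),
        mul_mem (aux_comm b₁ x.2.2) (aux_comm b₂ y.2.2)⟩, ?_⟩
      refine Prod.ext ?_ ?_
      · refine QuotientGroup.eq.2 (Subgroup.mem_subgroupOf.2 ?_)
        change (a₁ (b₁ x * b₂ y))⁻¹ * (x : FreeGroup α₁) ∈ _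
        rw [← QuotientGroup.eq, map_mul, QuotientGroup.mk_mul]
        have e1 := h11 x x.2.2
        have e2 := h12 y y.2.2
        simp only [MonoidHom.comp_apply, MonoidHom.id_apply, MonoidHom.one_apply] at e1 e2
        rw [e1, e2]; simp
      · refine QuotientGroup.eq.2 (Subgroup.mem_subgroupOf.2 ?_)
        change (a₂ (b₁ x * b₂ y))⁻¹ * (y : FreeGroup α₂) ∈ _
        rw [← QuotientGroup.eq, map_mul, QuotientGroup.mk_mul]
        have e1 := h22 y y.2.2
        have e2 := h21 x x.2.2
        simp only [MonoidHom.comp_apply, MonoidHom.id_apply, MonoidHom.one_apply] at e1 e2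
        rw [e1, e2]; simp
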